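/- Let n be an odd positive integer and 1 ≤ h ≤ (n−1)/2. For every integer r ≥ 0, if x^h·t^{n−2h} ∉ 𝓡₊ and n − 2h ≥ 2^r − 1, then 2^r divides n − h + 1. -/

import Mathlib

open MvPolynomial

/-- The polynomial `R_n(s, m) ∈ (ℤ/2)[x, t]` (with `x = X 0`, `t = X 1`):
`R_n(s,m) = Σ_i C(m,i)·C(s+1+m−i, n−2m−2i−2−s)·x^(m+1+i)·t^(n−2m−2i−2)`,
the sum running over `0 ≤ i ≤ m` with `n − 2m − 2i − 2 ≥ 0`, with the convention that a
binomial coefficient `C(α,β)` is `0` whenever `β < 0` or `α < β`. -/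
noncomputable def Rpoly (n s m : ℕ) : MvPolynomial (Fin 2) (ZMod 2) :=
  ∑ i ∈ Finset.range (m + 1),
    if 2 * m + 2 * i + 2 ≤ n then
      (if s ≤ n - (2 * m + 2 * i + 2) then
          ((m.choose i * (s + 1 + m - i).choose (n - (2 * m + 2 * i + 2) - s) : ℕ) : ZMod 2)
        else 0) •
        (X 0 ^ (m + 1 + i) * X 1 ^ (n - (2 * m + 2 * i + 2)))
    else 0

/-- `𝓡₊`: the `ℤ/2`-linear span of the polynomials `R_n(s, m)` for `(s, m) ∈ V_R`,
i.e. `s, m ≥ 0` and `s + 2m + 2 ≤ n - 1`. -/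
noncomputable def Rplus (n : ℕ) : Submodule (ZMod 2) (MvPolynomial (Fin 2) (ZMod 2)) :=
  Submodule.span (ZMod 2) {p | ∃ s m : ℕ, s + 2 * m + 2 ≤ n - 1 ∧ p = Rpoly n s m}

/-- `R₀ = Σ_{1 ≤ j ≤ n/2} C(n−j−1, n−2j)·x^j·t^(n−2j) ∈ (ℤ/2)[x, t]`. -/
noncomputable def Rzero (n : ℕ) : MvPolynomial (Fin 2) (ZMod 2) :=
  ∑ j ∈ Finset.Icc 1 (n / 2),
    (((n - j - 1).choose (n - 2 * j) : ℕ) : ZMod 2) • (X 0 ^ j * X 1 ^ (n - 2 * j))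

/-- If `2 ^ (k + 1)` divides `M + 1`, then `M.choose (2 ^ k)` is odd. -/
theorem choose_two_pow_mod_two (k M : ℕ) (hM : 2 ^ (k + 1) ∣ M + 1) :
    M.choose (2 ^ k) % 2 = 1 := by
  induction k generalizing M with
  | zero =>
    simp only [zero_add, pow_one, pow_zero, Nat.choose_one_right] at hM ⊢
    omega
  | succ k ih =>
    have : Fact (Nat.Prime 2) := ⟨Nat.prime_two⟩
    obtain ⟨c, hc⟩ := hM
    have hpow : 2 ^ (k + 1 + 1) * c = 2 * (2 ^ (k + 1) * c) := by ring
    have hdiv : 2 ^ (k + 1) ∣ M / 2 + 1 := ⟨c, by omega⟩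
    have hmod : M % 2 = 1 := by omega
    have hlucas : M.choose (2 ^ (k + 1)) ≡ _ [MOD 2] :=
      Choose.choose_modEq_choose_mod_mul_choose_div_nat
    have h2 : 2 ^ (k + 1) = 2 * 2 ^ k := by ring
    have h3 : 2 ^ (k + 1) % 2 = 0 := by omega
    have h4 : 2 ^ (k + 1) / 2 = 2 ^ k := by omega
    rw [hmod, h3, h4, Nat.choose_zero_right, one_mul] at hlucas
    exact Eq.trans hlucas (ih _ hdiv)

/-- A monomial `x ^ h * t ^ (n - 2 * h)` with `2 ^ r ≤ n - 2 * h + 1` lies in `Rplus n` as soon as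
`2 ^ r` does not divide `n + 1 - h`. -/
theorem monomial_mem_Rplus (n h r : ℕ) (h1 : 1 ≤ h) (hr : 2 ^ r + 2 * h ≤ n + 1)
    (hdvd : ¬ 2 ^ r ∣ n + 1 - h) :
    (X 0 ^ h * X 1 ^ (n - 2 * h) : MvPolynomial (Fin 2) (ZMod 2)) ∈ Rplus n := by
  induction r generalizing h with
  | zero => simp at hdvd
  | succ k ih =>
    have hpow : 2 ^ (k + 1) = 2 * 2 ^ k := by ring
    have hk : 0 < 2 ^ k := by positivity
    by_cases hkd : 2 ^ k ∣ n + 1 - h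
    swap
    · exact ih h h1 (by omega) hkd
    have hmem : Rpoly n (n - 2 * h - 2 ^ k) (h - 1) ∈ Rplus n :=
      Submodule.subset_span ⟨_, _, by omega, rfl⟩
    rw [Rpoly, Finset.sum_range_succ'] at hmem
    have hodd : (((n - h - 2 ^ k).choose (2 ^ k) : ℕ) : ZMod 2) = 1 := by
      have hdvd' : 2 ^ (k + 1) ∣ n - h - 2 ^ k + 1 := by
        obtain ⟨c, hc⟩ := hkd
        rcases Nat.even_or_odd' c with ⟨d, rfl | rfl⟩
        · exact absurd ⟨d, by rw [hc]; ring⟩ hdvd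
        · have h3 : 2 ^ k * (2 * d + 1) = 2 ^ (k + 1) * d + 2 ^ k := by ring
          exact ⟨d, by omega⟩
      have := choose_two_pow_mod_two k _ hdvd'
      rw [← Nat.cast_one, ZMod.natCast_eq_natCast_iff]
      exact this
    have e1 : n - 2 * h - 2 ^ k + 1 + (h - 1) - 0 = n - h - 2 ^ k := by omega
    have e2 : 2 * (h - 1) + 2 * 0 + 2 = 2 * h := by omega
    have e3 : n - 2 * h - (n - 2 * h - 2 ^ k) = 2 ^ k := by omega
    have e4 : h - 1 + 1 = h := by omega
    simp only [e4] at hmem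
    rw [add_zero, e1, e2, e3, if_pos (by omega), if_pos (by omega), Nat.choose_zero_right, one_mul, hodd,
      one_smul] at hmem
    refine (Submodule.add_mem_iff_right _ (Submodule.sum_mem _ fun i _ => ?_)).mp hmem
    split_ifs with hi hs
    · refine Submodule.smul_mem _ _ ?_
      have e6 : 2 * (h - 1) + 2 * (i + 1) + 2 = 2 * (h + (i + 1)) := by omega
      rw [e6]
      refine ih _ (by omega) (by omega) fun hd => ?_
      have hsub := Nat.dvd_sub hkd hd
      have e7 : n + 1 - h - (n + 1 - (h + (i + 1))) = i + 1 := by omega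
      rw [e7] at hsub
      have := Nat.le_of_dvd (by omega) hsub
      omega
    · simp
    · exact Submodule.zero_mem _

/-- Let `n` be odd and `1 ≤ h ≤ (n−1)/2`.  For every `r ≥ 0`, if `x^h·t^(n−2h) ∉ 𝓡₊` and
`n − 2h ≥ 2^r − 1`, then `2^r` divides `n − h + 1`. -/
theorem stmt8 (n h r : ℕ) (hn : Odd n) (hpos : 0 < n)
    (h1 : 1 ≤ h) (h2 : h ≤ (n - 1) / 2)
    (hnotmem : X 0 ^ h * X 1 ^ (n - 2 * h) ∉ Rplus n)
    (hr : 2 ^ r - 1 ≤ n - 2 * h) :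
    2 ^ r ∣ n - h + 1 := by
  by_contra hd
  have hpow : 0 < 2 ^ r := by positivity
  refine hnotmem (monomial_mem_Rplus n h r h1 (by omega) ?_)
  rwa [show n + 1 - h = n - h + 1 by omega]
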